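/- arXiv:math/0508239 — 5 statements merged into one kernel-verified Lean document; each statement's English description precedes it below -/
import Mathlib

section
/- Let H : ℝⁿ × ℝⁿ → ℝⁿ be twice continuously differentiable with H(x, 0) = 0 and D₂H(x, 0) = id for every x, where D₂ denotes the Fréchet derivative in the second argument. Let τ : ℝⁿ → ℝⁿ be continuously differentiable. Then for every x and every direction u ∈ ℝⁿ, the derivative at t = 0, in direction u, of the parallel-transport map t ↦ (D₂H(x, t))(τ(x + t)) equals (fderiv τ)(x)(u) + Γ(x)(u, τ(x)), where Γ(x) := D₂²H(x, 0) is the second derivative of H in its second argument at 0 (a symmetric bilinear map). (This is the derivation of the covariant derivative (26) — ∇_ν τ^μ = ∂_ν τ^μ + Γ^μ_{σν} τ^σ — from the parallel transport rule (25) determined by the multiplication law of the deformed translation group.) -/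
/-- **Derivation of the covariant derivative (26) from the parallel transport rule (25).**
Let `H : ℝⁿ × ℝⁿ → ℝⁿ` be `C²` with `H(x,0) = 0` and `D₂H(x,0) = id` for every `x`, and
let `τ : ℝⁿ → ℝⁿ` be `C¹`.  Then the derivative at `t = 0`, in direction `u`, of the
parallel-transport map `t ↦ (D₂H(x,t))(τ(x+t))` equals
`fderiv τ x u + Γ(x)(u, τ(x))`, where `Γ(x) = D₂²H(x,0)` is the second derivative of `H`
in its second argument at `0`. -/
theorem parallel_transport_gives_covariant_derivative
    {n : ℕ} (H : (Fin n → ℝ) × (Fin n → ℝ) → (Fin n → ℝ))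
    (hH : ContDiff ℝ 2 H)
    (hH0 : ∀ x : Fin n → ℝ, H (x, 0) = 0)
    (hHid : ∀ x : Fin n → ℝ,
      fderiv ℝ (fun t => H (x, t)) 0 = ContinuousLinearMap.id ℝ (Fin n → ℝ))
    (τ : (Fin n → ℝ) → (Fin n → ℝ)) (hτ : ContDiff ℝ 1 τ)
    (x u : Fin n → ℝ) :
    fderiv ℝ (fun t => fderiv ℝ (fun s => H (x, s)) t (τ (x + t))) 0 u
      = fderiv ℝ τ x u + (fderiv ℝ (fderiv ℝ (fun s => H (x, s))) 0 u) (τ x) := by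
  have hHx : ContDiff ℝ 2 fun s => H (x, s) := hH.comp (contDiff_const.prodMk contDiff_id)
  have hD : DifferentiableAt ℝ (fderiv ℝ fun s => H (x, s)) 0 :=
    ((hHx.fderiv_right (m := 1) (by norm_num)).differentiable (by norm_num)).differentiableAt
  have hτx : HasFDerivAt (fun t => τ (x + t)) (fderiv ℝ τ x) 0 := by
    have h : HasFDerivAt τ (fderiv ℝ τ x) (x + 0) := by
      rw [add_zero]
      exact (hτ.differentiable (by norm_num)).differentiableAt.hasFDerivAt
    exact h.comp 0 ((hasFDerivAt_id 0).const_add x)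
  rw [(hD.hasFDerivAt.clm_apply hτx).fderiv, hHid x]
  simp
end

section
/- Let H : ℝⁿ × ℝⁿ → ℝⁿ be twice continuously differentiable with H(x, 0) = 0 for all x, and let K : ℝⁿ × ℝⁿ → ℝⁿ be twice continuously differentiable with H(x, K(x, t)) = t and K(x, H(x, t)) = t for all x, t. Set h(x) := D₂H(x, 0) (an invertible linear map with inverse D₂K(x, 0)), and define the multiplication function of the deformed translation group by φ(x, t, t') := H( x, K(x, t) + K(x + K(x, t), t') ). Then for every x and all u, v ∈ ℝⁿ, the mixed second derivative ∂_t(direction u) ∂_{t'}(direction v) φ at (t, t') = (0, 0) equals D₂²H(x, 0)( h(x)⁻¹u, h(x)⁻¹v ) + h(x)( D_x( y ↦ h(y)⁻¹ v )(x)( h(x)⁻¹ u ) ). (This is formula (21) for the second-order structure coefficients γ(x)^m_{pn} = h^m_μ( Γ^μ_{pn} + h_p^ν ∂_ν h_n^μ ) of the deformed group T^{gH}_M.) -/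
/-- The section `y ↦ D₂K(y,0) v` of the partial derivative of a `C²` map is differentiable. -/
lemma differentiable_fderiv_snd_apply {E F G : Type*} [NormedAddCommGroup E] [NormedSpace ℝ E]
    [NormedAddCommGroup F] [NormedSpace ℝ F] [NormedAddCommGroup G] [NormedSpace ℝ G]
    {K : E × F → G} (hK : ContDiff ℝ 2 K) (a v : F) :
    Differentiable ℝ (fun y => fderiv ℝ (fun s => K (y, s)) a v) := by
  have h : ContDiff ℝ 1 (fun y => fderiv ℝ (fun s => K (y, s)) a) :=
    ContDiff.fderiv (f := fun y s => K (y, s)) (g := fun _ => a) hK contDiff_const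
      one_add_one_eq_two.le
  exact (h.differentiable one_ne_zero).clm_apply (differentiable_const v)

/-- The derivative in `t'` at `0` of `H(x, k + K(y, t'))` when `K(y, 0) = 0`. -/
lemma fderiv_comp_const_add_apply {E F G : Type*} [NormedAddCommGroup E] [NormedSpace ℝ E]
    [NormedAddCommGroup F] [NormedSpace ℝ F] [NormedAddCommGroup G] [NormedSpace ℝ G]
    {f : F → G} {g : E → F} (hf : Differentiable ℝ f) (hg : Differentiable ℝ g) (hg0 : g 0 = 0)
    (k : F) (v : E) :
    fderiv ℝ (fun t => f (k + g t)) 0 v = fderiv ℝ f k (fderiv ℝ g 0 v) := by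
  have hf' : HasFDerivAt f (fderiv ℝ f k) (k + g 0) := by
    simpa [hg0] using (hf k).hasFDerivAt
  have h := hf'.comp (0 : E) ((hg 0).hasFDerivAt.const_add k)
  exact congrArg (fun L : E →L[ℝ] G => L v) h.fderiv


/-- **Formula (21): the second-order structure coefficients of the deformed translation
group `T^{gH}_M`.**  Let `H, K : ℝⁿ × ℝⁿ → ℝⁿ` be `C²` with `H(x,0) = 0` and
`H(x, K(x,t)) = t`, `K(x, H(x,t)) = t` for all `x, t`, so that `h(x) := D₂H(x,0)` is an
invertible linear map with inverse `D₂K(x,0)`.  Define the multiplication function of the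
deformed translation group by `φ(x,t,t') := H(x, K(x,t) + K(x + K(x,t), t'))`.  Then the
mixed second derivative `∂_t(u) ∂_{t'}(v) φ` at `(t,t') = (0,0)` equals
`D₂²H(x,0)(h(x)⁻¹u, h(x)⁻¹v) + h(x)(D_x(y ↦ h(y)⁻¹v)(x)(h(x)⁻¹u))`, where `h(y)⁻¹` is
realized as `D₂K(y,0)`. -/
theorem deformed_group_second_order_structure_coefficients
    {n : ℕ} (H K : (Fin n → ℝ) × (Fin n → ℝ) → (Fin n → ℝ))
    (hH : ContDiff ℝ 2 H) (hK : ContDiff ℝ 2 K)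
    (hH0 : ∀ x : Fin n → ℝ, H (x, 0) = 0)
    (hHK : ∀ x t : Fin n → ℝ, H (x, K (x, t)) = t)
    (hKH : ∀ x t : Fin n → ℝ, K (x, H (x, t)) = t)
    (x u v : Fin n → ℝ) :
    fderiv ℝ (fun t =>
        fderiv ℝ (fun t' => H (x, K (x, t) + K (x + K (x, t), t'))) 0 v) 0 u
      = (fderiv ℝ (fderiv ℝ (fun s => H (x, s))) 0
            (fderiv ℝ (fun s => K (x, s)) 0 u))
          (fderiv ℝ (fun s => K (x, s)) 0 v)
        + (fderiv ℝ (fun s => H (x, s)) 0)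
            (fderiv ℝ (fun y => fderiv ℝ (fun s => K (y, s)) 0 v) x
              (fderiv ℝ (fun s => K (x, s)) 0 u)) := by
  have hK0 : ∀ y, K (y, 0) = 0 := fun y => by simpa [hH0] using hKH y 0
  have hHx : ContDiff ℝ 2 (fun s => H (x, s)) := hH.comp (contDiff_prodMk_right x)
  have hKd : ∀ y, Differentiable ℝ (fun s => K (y, s)) := fun y =>
    (hK.comp (contDiff_prodMk_right y)).differentiable two_ne_zero
  have hinner : (fun t => fderiv ℝ (fun t' => H (x, K (x, t) + K (x + K (x, t), t'))) 0 v)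
      = fun t => fderiv ℝ (fun s => H (x, s)) (K (x, t))
          (fderiv ℝ (fun s => K (x + K (x, t), s)) 0 v) := by
    funext t
    exact fderiv_comp_const_add_apply (hHx.differentiable two_ne_zero)
      (hKd (x + K (x, t))) (hK0 _) (K (x, t)) v
  have hk : HasFDerivAt (fun t => K (x, t)) (fderiv ℝ (fun s => K (x, s)) 0) 0 :=
    (hKd x 0).hasFDerivAt
  have hA : HasFDerivAt (fderiv ℝ (fun s => H (x, s)))
      (fderiv ℝ (fderiv ℝ (fun s => H (x, s))) 0) (K (x, 0)) := by
    rw [hK0]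
    exact ((hHx.fderiv_right one_add_one_eq_two.le).differentiable one_ne_zero 0).hasFDerivAt
  have hB : HasFDerivAt (fun y => fderiv ℝ (fun s => K (y, s)) 0 v)
      (fderiv ℝ (fun y => fderiv ℝ (fun s => K (y, s)) 0 v) x) (x + K (x, 0)) := by
    simpa [hK0] using (differentiable_fderiv_snd_apply hK 0 v x).hasFDerivAt
  have h := (hA.comp 0 hk).clm_apply (hB.comp 0 (hk.const_add x))
  rw [hinner]
  refine (congrArg (fun L : (Fin n → ℝ) →L[ℝ] (Fin n → ℝ) => L u) h.fderiv).trans ?_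
  simp [hK0, add_comm]
end

section
/- Let h : ℝⁿ → Matrix (Fin n) (Fin n) ℝ be continuously differentiable with h(x) invertible for all x; write h^m_μ(x) = h(x)_{mμ} and h_a^μ(x) = (h(x)⁻¹)_{μa}. Let Γ : ℝⁿ → (Fin n → Fin n → Fin n → ℝ) be a field of coefficients Γ^μ_{νρ} symmetric in ν, ρ, and define γ^m_{pn}(x) := Σ_{μ,ν,ρ} h^m_μ(x)( Γ^μ_{νρ}(x) h_p^ν(x) h_n^ρ(x) ) + Σ_{μ,ν} h^m_μ(x) h_p^ν(x) ∂_ν h_n^μ(x). Then: (i) γ^m_{pn}(x) − γ^m_{np}(x) = Σ_{μ,ν} h^m_μ(x)( h_p^ν(x) ∂_ν h_n^μ(x) − h_n^ν(x) ∂_ν h_p^μ(x) ); and (ii) Σ_{p,n} ( γ^m_{pn}(x) − γ^m_{np}(x) ) h^p_μ(x) h^n_ρ(x) = −( ∂_μ h^m_ρ(x) − ∂_ρ h^m_μ(x) ). (This is formula (23): the structure functions of the deformed translation group T^{gH}_M are the anholonomy coefficients F^n_{μν} = −(∂_μ h^n_ν − ∂_ν h^n_μ).) -/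
/- Entrywise sup-norm on matrices, so that `ContDiff` makes sense for
matrix-valued maps. -/
attribute [local instance] Matrix.normedAddCommGroup Matrix.normedSpace

theorem Matrix.differentiableAt_det {ι E : Type*} [Fintype ι] [DecidableEq ι]
    [NormedAddCommGroup E] [NormedSpace ℝ E] {A : E → Matrix ι ι ℝ} {x : E}
    (hA : ∀ i j, DifferentiableAt ℝ (fun y => A y i j) x) :
    DifferentiableAt ℝ (fun y => (A y).det) x := by
  simp only [Matrix.det_apply']
  fun_prop

theorem Matrix.differentiableAt_inv_apply {ι E : Type*} [Fintype ι] [DecidableEq ι]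
    [NormedAddCommGroup E] [NormedSpace ℝ E] {A : E → Matrix ι ι ℝ} {x : E}
    (hA : ∀ i j, DifferentiableAt ℝ (fun y => A y i j) x) (hx : IsUnit (A x)) (i j : ι) :
    DifferentiableAt ℝ (fun y => (A y)⁻¹ i j) x := by
  have hdet : (A x).det ≠ 0 := ((Matrix.isUnit_iff_isUnit_det _).mp hx).ne_zero
  simp only [Matrix.inv_def, Matrix.smul_apply, smul_eq_mul, Ring.inverse_eq_inv',
    Matrix.adjugate_apply]
  refine ((Matrix.differentiableAt_det hA).inv hdet).mul (Matrix.differentiableAt_det ?_)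
  intro k l
  rcases eq_or_ne k j with rfl | hk
  · simp only [Matrix.updateRow_self]
    fun_prop
  · simpa only [Matrix.updateRow_ne hk] using hA k l

/-- The derivative of the inverse: `A (∂_v A⁻¹) A = -∂_v A`. -/
theorem Matrix.mul_fderiv_inv_mul {ι E : Type*} [Fintype ι] [DecidableEq ι]
    [NormedAddCommGroup E] [NormedSpace ℝ E] {A : E → Matrix ι ι ℝ}
    (x v : E) (hA : ∀ i j, DifferentiableAt ℝ (fun y => A y i j) x) (hu : ∀ y, IsUnit (A y)) :
    A x * Matrix.of (fun i j => fderiv ℝ (fun y => (A y)⁻¹ i j) x v) * A x =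
      -Matrix.of (fun i j => fderiv ℝ (fun y => A y i j) x v) := by
  have hdet (y : E) : IsUnit (A y).det := (Matrix.isUnit_iff_isUnit_det _).mp (hu y)
  have hB := Matrix.differentiableAt_inv_apply hA (hu x)
  have key : A x * Matrix.of (fun i j => fderiv ℝ (fun y => (A y)⁻¹ i j) x v) +
      Matrix.of (fun i j => fderiv ℝ (fun y => A y i j) x v) * (A x)⁻¹ = 0 := by
    ext i j
    have hconst : (fun y => ∑ k, A y i k * (A y)⁻¹ k j) =
        fun _ => (1 : Matrix ι ι ℝ) i j := by
      funext y
      rw [← Matrix.mul_apply, Matrix.mul_nonsing_inv _ (hdet y)]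
    have hd := congrArg (fun f => fderiv ℝ f x v) hconst
    simp only [fderiv_const_apply] at hd
    rw [fderiv_fun_sum (fun k _ => (hA i k).fun_mul (hB k j))] at hd
    simp only [fderiv_fun_mul (hA i _) (hB _ j), _root_.sum_apply,
      _root_.add_apply, _root_.smul_apply, smul_eq_mul,
      _root_.zero_apply, Finset.sum_add_distrib] at hd
    simpa [Matrix.mul_apply, mul_comm] using hd
  rw [eq_neg_of_add_eq_zero_left key, neg_mul, Matrix.nonsing_inv_mul_cancel_right _ _ (hdet x)]

open scoped Matrix in
/-- Contracting the frame index of `∑ A m s * B ν p * D ν s q` with `A`, where `B A = 1`. -/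
theorem Matrix.sum_frame_contraction {ι : Type*} [Fintype ι] [DecidableEq ι]
    {A B : Matrix ι ι ℝ} (hBA : B * A = 1) (D : ι → Matrix ι ι ℝ) (m μ ρ : ι) :
    ∑ p, ∑ q, (∑ s, ∑ ν, A m s * (B ν p * D ν s q)) * A p μ * A q ρ =
      (A * D μ * A) m ρ := by
  let C : Matrix ι ι ℝ := Matrix.of fun ν q => (A * D ν) m q
  have hK (p q : ι) : ∑ s, ∑ ν, A m s * (B ν p * D ν s q) = (Bᵀ * C) p q := by
    rw [Finset.sum_comm]
    simp only [C, Matrix.mul_apply, Matrix.transpose_apply, Matrix.of_apply, Finset.mul_sum]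
    exact Finset.sum_congr rfl fun _ _ => Finset.sum_congr rfl fun _ _ => by ring
  have hC : Aᵀ * (Bᵀ * C) * A = C * A := by
    rw [← Matrix.mul_assoc, ← Matrix.transpose_mul, hBA, Matrix.transpose_one, Matrix.one_mul]
  calc _ = (Aᵀ * (Bᵀ * C) * A) μ ρ := by
        simp only [hK]
        rw [Matrix.mul_apply, Finset.sum_comm]
        refine Finset.sum_congr rfl fun q _ => ?_
        rw [Matrix.mul_apply, Finset.sum_mul]
        exact Finset.sum_congr rfl fun p _ => by rw [Matrix.transpose_apply]; ring
    _ = (A * D μ * A) m ρ := by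
        rw [hC, Matrix.mul_apply, Matrix.mul_apply]
        rfl

/-- **Formula (23): the structure functions of the deformed translation group `T^{gH}_M`
are the anholonomy coefficients.**  Let `h : ℝⁿ → Matrix (Fin n) (Fin n) ℝ` be `C¹` and
pointwise invertible, with entries `h^m_μ(x) = h x m μ` and inverse entries
`h_a^μ(x) = (h x)⁻¹ μ a`.  Let `Γ` be a field of connection coefficients `Γ^μ_{νρ}`,
symmetric in `ν, ρ`, and define (formula (21))
`γ^m_{pn}(x) = Σ_{μ,ν,ρ} h^m_μ Γ^μ_{νρ} h_p^ν h_n^ρ + Σ_{μ,ν} h^m_μ h_p^ν ∂_ν h_n^μ`.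
Then (i) `γ^m_{pn} − γ^m_{np} = Σ_{μ,ν} h^m_μ (h_p^ν ∂_ν h_n^μ − h_n^ν ∂_ν h_p^μ)`, and
(ii) `Σ_{p,n} (γ^m_{pn} − γ^m_{np}) h^p_μ h^n_ρ = −(∂_μ h^m_ρ − ∂_ρ h^m_μ)`. -/
theorem deformed_translation_group_anholonomy
    {n : ℕ} (h : (Fin n → ℝ) → Matrix (Fin n) (Fin n) ℝ)
    (hC : ContDiff ℝ 1 h) (hinv : ∀ x, IsUnit (h x))
    (Γ : (Fin n → ℝ) → Fin n → Fin n → Fin n → ℝ)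
    (hΓsymm : ∀ x μ ν ρ, Γ x μ ν ρ = Γ x μ ρ ν)
    (γ : Fin n → Fin n → Fin n → (Fin n → ℝ) → ℝ)
    (hγ : ∀ m p q x, γ m p q x =
      (∑ μ, ∑ ν, ∑ ρ, h x m μ * (Γ x μ ν ρ * (h x)⁻¹ ν p * (h x)⁻¹ ρ q))
        + ∑ μ, ∑ ν, h x m μ * (h x)⁻¹ ν p
            * fderiv ℝ (fun y => (h y)⁻¹ μ q) x (Pi.single ν 1)) :
    (∀ m p q x, γ m p q x - γ m q p x =
        ∑ μ, ∑ ν, h x m μ *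
          ((h x)⁻¹ ν p * fderiv ℝ (fun y => (h y)⁻¹ μ q) x (Pi.single ν 1)
            - (h x)⁻¹ ν q * fderiv ℝ (fun y => (h y)⁻¹ μ p) x (Pi.single ν 1)))
    ∧ (∀ m μ ρ x, (∑ p, ∑ q, (γ m p q x - γ m q p x) * h x p μ * h x q ρ)
        = -(fderiv ℝ (fun y => h y m ρ) x (Pi.single μ 1)
            - fderiv ℝ (fun y => h y m μ) x (Pi.single ρ 1))) := by
  have hA (x : Fin n → ℝ) (i j : Fin n) : DifferentiableAt ℝ (fun y => h y i j) x :=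
    differentiableAt_pi.mp
      (differentiableAt_pi.mp ((hC.differentiable one_ne_zero).differentiableAt (x := x)) i) j
  have hanti (m p q x) : γ m p q x - γ m q p x =
      ∑ μ, ∑ ν, h x m μ *
        ((h x)⁻¹ ν p * fderiv ℝ (fun y => (h y)⁻¹ μ q) x (Pi.single ν 1)
          - (h x)⁻¹ ν q * fderiv ℝ (fun y => (h y)⁻¹ μ p) x (Pi.single ν 1)) := by
    have hsymm : ∑ μ, ∑ ν, ∑ ρ, h x m μ * (Γ x μ ν ρ * (h x)⁻¹ ν p * (h x)⁻¹ ρ q) =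
        ∑ μ, ∑ ν, ∑ ρ, h x m μ * (Γ x μ ν ρ * (h x)⁻¹ ν q * (h x)⁻¹ ρ p) := by
      refine Finset.sum_congr rfl fun μ _ => ?_
      rw [Finset.sum_comm]
      refine Finset.sum_congr rfl fun ν _ => Finset.sum_congr rfl fun ρ _ => ?_
      rw [hΓsymm x μ ρ ν]
      ring
    rw [hγ, hγ, hsymm, add_sub_add_left_eq_sub]
    simp only [mul_sub, Finset.sum_sub_distrib, mul_assoc]
  refine ⟨hanti, fun m μ ρ x => ?_⟩
  have hBA : (h x)⁻¹ * h x = 1 :=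
    Matrix.nonsing_inv_mul _ ((Matrix.isUnit_iff_isUnit_det _).mp (hinv x))
  let D (ν : Fin n) : Matrix (Fin n) (Fin n) ℝ :=
    Matrix.of fun i j => fderiv ℝ (fun y => (h y)⁻¹ i j) x (Pi.single ν 1)
  have hterm (μ ρ : Fin n) :
      ∑ p, ∑ q, (∑ s, ∑ ν, h x m s * ((h x)⁻¹ ν p * D ν s q)) * h x p μ * h x q ρ =
        -fderiv ℝ (fun y => h y m ρ) x (Pi.single μ 1) := by
    rw [Matrix.sum_frame_contraction hBA,
      Matrix.mul_fderiv_inv_mul x (Pi.single μ 1) (hA x) hinv]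
    rfl
  have hswap :
      ∑ p, ∑ q, (∑ s, ∑ ν, h x m s * ((h x)⁻¹ ν q * D ν s p)) * h x p μ * h x q ρ =
        -fderiv ℝ (fun y => h y m μ) x (Pi.single ρ 1) := by
    rw [← hterm ρ μ, Finset.sum_comm]
    exact Finset.sum_congr rfl fun _ _ => Finset.sum_congr rfl fun _ _ => mul_right_comm _ _ _
  rw [neg_sub', ← hterm μ ρ, ← hswap]
  simp only [hanti, D, Matrix.of_apply, mul_sub, sub_mul, Finset.sum_sub_distrib]
end

section
/- Let h : ℝⁿ → Matrix (Fin n) (Fin n) ℝ be invertible pointwise with entries h^m_μ(x) = h(x)_{mμ} and inverse entries h_a^μ(x) = (h(x)⁻¹)_{μa}. Let Γ : ℝⁿ → (Fin n → Fin n → Fin n → ℝ) be continuously differentiable with Γ^μ_{νρ} = Γ^μ_{ρν}, and let Δ : ℝⁿ → (Fin n → Fin n → Fin n → Fin n → ℝ) have Δ^μ_{νρσ} totally symmetric in ν, ρ, σ. Define (formula (22)) ρ^m_{prn}(x) := Σ h^m_μ ( Δ^μ_{νρσ} h_p^ν h_r^ρ h_n^σ − Σ_{ν,σ,π,ρ'}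 Γ^μ_{νσ} h_n^ν Γ^σ_{πρ'} h_p^π h_r^{ρ'} − Σ_{ν,π,ρ'} h_n^ν (∂_ν Γ^μ_{πρ'}) h_p^π h_r^{ρ'} ) (all evaluated at x). Then the curvature coefficients R^m_{prn} := ρ^m_{prn} − ρ^m_{pnr} satisfy R^m_{prn}(x) = Σ_{μ,ρ',π,ν} h^m_μ(x) h_p^{ρ'}(x) h_r^π(x) h_n^ν(x) · R^μ_{ρ'πν}(x), where R^μ_{ρπν} = ∂_π Γ^μ_{νρ} − ∂_ν Γ^μ_{πρ} + Σ_σ ( Γ^μ_{πσ} Γ^σ_{νρ} − Γ^μ_{νσ} Γ^σ_{πρ} ) is the Riemann curvature tensor of the connection Γ (formula (24)). (This shows the curvature coefficients of the deformed group T^{gH}_M coincide with the Riemann curvature tensor.) -/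
theorem sum_rotate_three {ι M : Type*} [Fintype ι] [AddCommMonoid M] (f : ι → ι → ι → M) :
    ∑ c, ∑ a, ∑ b, f c a b = ∑ a, ∑ b, ∑ c, f c a b := by
  rw [Finset.sum_comm]
  exact Finset.sum_congr rfl fun a _ => Finset.sum_comm

theorem sum_rotate_four {ι M : Type*} [Fintype ι] [AddCommMonoid M] (f : ι → ι → ι → ι → M) :
    ∑ c, ∑ s, ∑ a, ∑ b, f c s a b = ∑ a, ∑ b, ∑ c, ∑ s, f c s a b := by
  rw [← sum_rotate_three fun c a b => ∑ s, f c s a b]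
  exact Finset.sum_congr rfl fun c _ => sum_rotate_three (f c)

/-- **Formulas (22), (24) and (7): the curvature coefficients of the deformed translation
group `T^{gH}_M` coincide with the Riemann curvature tensor.**  Let
`h : ℝⁿ → Matrix (Fin n) (Fin n) ℝ` be pointwise invertible, with entries
`h^m_μ(x) = h x m μ` and inverse entries `h_a^μ(x) = (h x)⁻¹ μ a`.  Let `Γ` be a `C¹`
field of connection coefficients with `Γ^μ_{νρ} = Γ^μ_{ρν}`, and `Δ` a field of
coefficients `Δ^μ_{νρσ}` totally symmetric in `ν, ρ, σ`.  Define (formula (22))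
`ρ^m_{prn} = Σ h^m_μ (Δ^μ_{νρσ} h_p^ν h_r^ρ h_n^σ − Γ^μ_{νσ} h_n^ν Γ^σ_{πρ'} h_p^π h_r^{ρ'}
  − h_n^ν (∂_ν Γ^μ_{πρ'}) h_p^π h_r^{ρ'})`.
Then the curvature coefficients `R^m_{prn} = ρ^m_{prn} − ρ^m_{pnr}` satisfy
`R^m_{prn} = Σ h^m_μ h_p^{ρ'} h_r^π h_n^ν R^μ_{ρ'πν}`, where
`R^μ_{ρπν} = ∂_π Γ^μ_{νρ} − ∂_ν Γ^μ_{πρ} + Σ_σ (Γ^μ_{πσ} Γ^σ_{νρ} − Γ^μ_{νσ} Γ^σ_{πρ})`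
is the Riemann curvature tensor of `Γ` (formula (24)). -/
theorem deformed_group_curvature_coefficients_eq_riemann
    {n : ℕ} (h : (Fin n → ℝ) → Matrix (Fin n) (Fin n) ℝ)
    (hinv : ∀ x, IsUnit (h x))
    (Γ : (Fin n → ℝ) → Fin n → Fin n → Fin n → ℝ)
    (hΓC : ∀ μ π ρ, ContDiff ℝ 1 (fun y => Γ y μ π ρ))
    (hΓsymm : ∀ x μ ν ρ, Γ x μ ν ρ = Γ x μ ρ ν)
    (Δ : (Fin n → ℝ) → Fin n → Fin n → Fin n → Fin n → ℝ)
    (hΔsymm : ∀ x μ ν ρ σ, Δ x μ ν ρ σ = Δ x μ ρ ν σ ∧ Δ x μ ν ρ σ = Δ x μ ν σ ρ)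
    (ρc : Fin n → Fin n → Fin n → Fin n → (Fin n → ℝ) → ℝ)
    (hρc : ∀ m p r q x, ρc m p r q x =
      ∑ μ, h x m μ *
        ((∑ ν, ∑ ρ, ∑ σ, Δ x μ ν ρ σ * (h x)⁻¹ ν p * (h x)⁻¹ ρ r * (h x)⁻¹ σ q)
          - (∑ ν, ∑ σ, ∑ π, ∑ ρ',
              Γ x μ ν σ * (h x)⁻¹ ν q * Γ x σ π ρ' * (h x)⁻¹ π p * (h x)⁻¹ ρ' r)
          - ∑ ν, ∑ π, ∑ ρ',
              (h x)⁻¹ ν q * fderiv ℝ (fun y => Γ y μ π ρ') x (Pi.single ν 1)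
                * (h x)⁻¹ π p * (h x)⁻¹ ρ' r))
    (Riem : (Fin n → ℝ) → Fin n → Fin n → Fin n → Fin n → ℝ)
    (hRiem : ∀ x μ ρ π ν, Riem x μ ρ π ν =
      fderiv ℝ (fun y => Γ y μ ν ρ) x (Pi.single π 1)
        - fderiv ℝ (fun y => Γ y μ π ρ) x (Pi.single ν 1)
        + ∑ σ, (Γ x μ π σ * Γ x σ ν ρ - Γ x μ ν σ * Γ x σ π ρ)) :
    ∀ m p r q x, ρc m p r q x - ρc m p q r x =
      ∑ μ, ∑ ρ', ∑ π, ∑ ν,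
        h x m μ * (h x)⁻¹ ρ' p * (h x)⁻¹ π r * (h x)⁻¹ ν q * Riem x μ ρ' π ν := by
  set A : (Fin n → ℝ) → Fin n → Fin n → Fin n → Fin n → ℝ := fun x μ a b c =>
    Δ x μ a b c - ∑ σ, Γ x μ c σ * Γ x σ a b
      - fderiv ℝ (fun y => Γ y μ a b) x (Pi.single c 1) with hA
  have hρA : ∀ m p r q x, ρc m p r q x = ∑ μ, ∑ a, ∑ b, ∑ c,
      h x m μ * (h x)⁻¹ a p * (h x)⁻¹ b r * (h x)⁻¹ c q * A x μ a b c := by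
    intro m p r q x
    rw [hρc]
    refine Finset.sum_congr rfl fun μ _ => ?_
    rw [sum_rotate_four fun ν σ π ρ' =>
        Γ x μ ν σ * (h x)⁻¹ ν q * Γ x σ π ρ' * (h x)⁻¹ π p * (h x)⁻¹ ρ' r,
      sum_rotate_three fun ν π ρ' =>
        (h x)⁻¹ ν q * fderiv ℝ (fun y => Γ y μ π ρ') x (Pi.single ν 1)
          * (h x)⁻¹ π p * (h x)⁻¹ ρ' r]
    simp only [← Finset.sum_sub_distrib, Finset.mul_sum]
    refine Finset.sum_congr rfl fun a _ => Finset.sum_congr rfl fun b _ =>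
      Finset.sum_congr rfl fun c _ => ?_
    have hΓΓ : ∑ σ, Γ x μ c σ * (h x)⁻¹ c q * Γ x σ a b * (h x)⁻¹ a p * (h x)⁻¹ b r =
        (∑ σ, Γ x μ c σ * Γ x σ a b) * ((h x)⁻¹ c q * (h x)⁻¹ a p * (h x)⁻¹ b r) := by
      rw [Finset.sum_mul]
      exact Finset.sum_congr rfl fun σ _ => by ring
    rw [hΓΓ, hA]
    ring
  have hRA : ∀ x μ a b c, Riem x μ a b c = A x μ a b c - A x μ a c b := by
    intro x μ a b c
    have hd : ∀ i j, (fun y => Γ y μ i j) = fun y => Γ y μ j i := fun i j =>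
      funext fun y => hΓsymm y μ i j
    simp only [hRiem, hA, Finset.sum_sub_distrib]
    rw [hd c a, hd b a, (hΔsymm x μ a b c).2]
    simp only [hΓsymm x _ c a, hΓsymm x _ b a]
    ring
  intro m p r q x
  rw [hρA, hρA, ← Finset.sum_sub_distrib]
  refine Finset.sum_congr rfl fun μ _ => ?_
  rw [← Finset.sum_sub_distrib]
  refine Finset.sum_congr rfl fun a _ => ?_
  rw [Finset.sum_comm (f := fun b c =>
    h x m μ * (h x)⁻¹ a p * (h x)⁻¹ b q * (h x)⁻¹ c r * A x μ a b c)]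
  simp only [← Finset.sum_sub_distrib]
  refine Finset.sum_congr rfl fun b _ => Finset.sum_congr rfl fun c _ => ?_
  rw [hRA]
  ring
end

section
/- Let h : ℝⁿ → Matrix (Fin n) (Fin n) ℝ be continuously differentiable with h(x) invertible for all x (entries h^m_μ, inverse entries h_a^μ), and let η be a constant symmetric invertible n×n real matrix. Define the metric g_{μν}(x) := Σ_{m,n} h^m_μ(x) η_{mn} h^n_ν(x), with inverse entries g^{ρσ}(x). Let Γ : ℝⁿ → (Fin n → Fin n → Fin n → ℝ) satisfy Γ^μ_{νρ} = Γ^μ_{ρν}, and define γ^m_{pn}(x) := Σ h^m_μ(Γ^μ_{νρ} h_p^ν h_n^ρ + h_p^ν ∂_ν h_n^μ) as in formula (21). If the metricity condition Σ_a η_{ma} γ^a_{sn}(x) + Σ_a η_{na} γ^a_{sm}(x) = 0 holds for all indices m, s, n and all x, then Γ coincides with the Christoffel symbols of g: Γ^ρ_{μν}(x) = ½ Σ_σ g^{ρσ}(x) ( ∂_μ g_{νσ}(x) + ∂_ν g_{μσ}(x) − ∂_σ g_{μν}(x) ) (formula (27)). -/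
/- Entrywise sup-norm on matrices, so that `ContDiff` makes sense for
matrix-valued maps. -/
attribute [local instance] Matrix.normedAddCommGroup Matrix.normedSpace

open scoped Matrix

section EntrywiseDerivative

variable {E : Type*} [NormedAddCommGroup E] [NormedSpace ℝ E] {l m k : Type*}

/-- The derivative at `x` in the direction `v` of a matrix-valued map, taken entrywise. -/
noncomputable def entryDeriv (A : E → Matrix l m ℝ) (x v : E) : Matrix l m ℝ :=
  Matrix.of fun i j => fderiv ℝ (fun y => A y i j) x v

theorem entryDeriv_const (A : Matrix l m ℝ) (x v : E) : entryDeriv (fun _ => A) x v = 0 := by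
  ext i j
  simp [entryDeriv]

theorem entryDeriv_transpose (A : E → Matrix l m ℝ) (x v : E) :
    entryDeriv (fun y => (A y)ᵀ) x v = (entryDeriv A x v)ᵀ := rfl

variable [Fintype m]

theorem entryDeriv_mul {A : E → Matrix l m ℝ} {B : E → Matrix m k ℝ} {x : E}
    (hA : ∀ i j, DifferentiableAt ℝ (fun y => A y i j) x)
    (hB : ∀ i j, DifferentiableAt ℝ (fun y => B y i j) x) (v : E) :
    entryDeriv (fun y => A y * B y) x v = entryDeriv A x v * B x + A x * entryDeriv B x v := by
  ext i j
  simp only [entryDeriv, Matrix.of_apply, Matrix.mul_apply, Matrix.add_apply]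
  rw [fderiv_fun_sum fun a _ => (hA i a).fun_mul (hB a j), sum_apply, ← Finset.sum_add_distrib]
  refine Finset.sum_congr rfl fun a _ => ?_
  rw [fderiv_fun_mul (hA i a) (hB a j)]
  simp only [add_apply, smul_apply, smul_eq_mul]
  ring

theorem differentiableAt_matrix_mul_apply {A : E → Matrix l m ℝ} {B : E → Matrix m k ℝ} {x : E}
    (hA : ∀ i j, DifferentiableAt ℝ (fun y => A y i j) x)
    (hB : ∀ i j, DifferentiableAt ℝ (fun y => B y i j) x) (i : l) (j : k) :
    DifferentiableAt ℝ (fun y => (A y * B y) i j) x := by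
  simp only [Matrix.mul_apply]
  fun_prop

variable [DecidableEq m]

theorem differentiableAt_matrix_det {A : E → Matrix m m ℝ} {x : E}
    (hA : ∀ i j, DifferentiableAt ℝ (fun y => A y i j) x) :
    DifferentiableAt ℝ (fun y => (A y).det) x := by
  simp only [Matrix.det_apply']
  fun_prop

theorem differentiableAt_matrix_inv_apply {A : E → Matrix m m ℝ} {x : E}
    (hA : ∀ i j, DifferentiableAt ℝ (fun y => A y i j) x) (hx : IsUnit (A x)) (i j : m) :
    DifferentiableAt ℝ (fun y => (A y)⁻¹ i j) x := by
  have hdet : (A x).det ≠ 0 := ((Matrix.isUnit_iff_isUnit_det _).1 hx).ne_zero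
  simp only [Matrix.inv_def, Matrix.smul_apply, Ring.inverse_eq_inv', smul_eq_mul,
    Matrix.adjugate_apply]
  refine ((differentiableAt_matrix_det hA).inv hdet).mul (differentiableAt_matrix_det ?_)
  intro a b
  simp only [Matrix.updateRow_apply]
  split_ifs
  · exact differentiableAt_const _
  · exact hA a b

theorem mul_entryDeriv_inv {A : E → Matrix m m ℝ} {x : E}
    (hA : ∀ i j, DifferentiableAt ℝ (fun y => A y i j) x) (hU : ∀ y, IsUnit (A y)) (v : E) :
    A x * entryDeriv (fun y => (A y)⁻¹) x v = -(entryDeriv A x v * (A x)⁻¹) := by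
  have h1 := entryDeriv_mul hA (differentiableAt_matrix_inv_apply hA (hU x)) v
  have h2 : (fun y => A y * (A y)⁻¹) = fun _ => 1 :=
    funext fun y => Matrix.mul_nonsing_inv _ ((Matrix.isUnit_iff_isUnit_det _).1 (hU y))
  rw [h2, entryDeriv_const] at h1
  exact (neg_eq_of_add_eq_zero_right h1.symm).symm

end EntrywiseDerivative

/-- A connection `Γ`, symmetric in its lower indices, whose contractions with an invertible
matrix `g` satisfy `∂_τ g = g Γ_τ + (g Γ_τ)ᵀ`, is given by the Christoffel formula. -/
theorem christoffel_of_deriv_eq {ι : Type*} [Fintype ι] [DecidableEq ι]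
    {g : Matrix ι ι ℝ} (hg : IsUnit g) {dg : ι → Matrix ι ι ℝ} {G : ι → ι → ι → ℝ}
    (hG : ∀ μ ν ρ, G μ ν ρ = G μ ρ ν)
    (hdg : ∀ τ, dg τ = g * Matrix.of (fun μ ρ => G μ τ ρ)
      + (g * Matrix.of (fun μ ρ => G μ τ ρ))ᵀ) (ρ μ ν : ι) :
    G ρ μ ν = (1 / 2) * ∑ σ, g⁻¹ ρ σ * (dg μ ν σ + dg ν μ σ - dg σ μ ν) := by
  have key : ∀ σ, dg μ ν σ + dg ν μ σ - dg σ μ ν = 2 * (g *ᵥ fun a => G a μ ν) σ := by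
    intro σ
    have e : ∀ a b c, (g * Matrix.of (fun μ ρ => G μ b ρ)) a c = (g *ᵥ fun d => G d b c) a :=
      fun a b c => rfl
    simp only [hdg, Matrix.add_apply, Matrix.transpose_apply, e]
    simp only [fun d => hG d ν μ, fun d => hG d σ μ, fun d => hG d σ ν]
    ring
  have hdet := (Matrix.isUnit_iff_isUnit_det _).1 hg
  have inv : g⁻¹ *ᵥ (g *ᵥ fun a => G a μ ν) = fun a => G a μ ν := by
    rw [Matrix.mulVec_mulVec, Matrix.nonsing_inv_mul _ hdet, Matrix.one_mulVec]
  have h2 := congrFun inv ρ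
  simp only [key]
  rw [← h2, Matrix.mulVec, dotProduct, Finset.mul_sum]
  exact Finset.sum_congr rfl fun σ _ => by ring

/-- **Formula (27): the metricity condition forces `Γ` to be the Christoffel symbols.**
Let `h : ℝⁿ → Matrix (Fin n) (Fin n) ℝ` be `C¹` and pointwise invertible (entries
`h^m_μ = h x m μ`, inverse entries `h_a^μ = (h x)⁻¹ μ a`), and `η` a constant symmetric
invertible matrix.  Define the metric `g_{μν}(x) = Σ_{m,n} h^m_μ η_{mn} h^n_ν`.  Let `Γ`
be symmetric in its lower indices and `γ^m_{pn} = Σ h^m_μ (Γ^μ_{νρ} h_p^ν h_n^ρ +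
h_p^ν ∂_ν h_n^μ)` as in formula (21).  If the metricity condition
`Σ_a η_{ma} γ^a_{sn} + Σ_a η_{na} γ^a_{sm} = 0` holds identically, then `Γ` coincides
with the Christoffel symbols of `g`:
`Γ^ρ_{μν} = ½ Σ_σ g^{ρσ} (∂_μ g_{νσ} + ∂_ν g_{μσ} − ∂_σ g_{μν})`. -/
theorem metricity_implies_christoffel
    {n : ℕ} (h : (Fin n → ℝ) → Matrix (Fin n) (Fin n) ℝ)
    (hC : ContDiff ℝ 1 h) (hinv : ∀ x, IsUnit (h x))
    (η : Matrix (Fin n) (Fin n) ℝ) (hηsymm : η.IsSymm) (hηinv : IsUnit η)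
    (g : (Fin n → ℝ) → Matrix (Fin n) (Fin n) ℝ)
    (hg : ∀ x μ ν, g x μ ν = ∑ m, ∑ q, h x m μ * η m q * h x q ν)
    (Γ : (Fin n → ℝ) → Fin n → Fin n → Fin n → ℝ)
    (hΓsymm : ∀ x μ ν ρ, Γ x μ ν ρ = Γ x μ ρ ν)
    (γ : Fin n → Fin n → Fin n → (Fin n → ℝ) → ℝ)
    (hγ : ∀ m p q x, γ m p q x =
      ∑ μ, h x m μ *
        ((∑ ν, ∑ ρ, Γ x μ ν ρ * (h x)⁻¹ ν p * (h x)⁻¹ ρ q)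
          + ∑ ν, (h x)⁻¹ ν p * fderiv ℝ (fun y => (h y)⁻¹ μ q) x (Pi.single ν 1)))
    (hmetricity : ∀ (m s q : Fin n) (x : Fin n → ℝ),
      (∑ a, η m a * γ a s q x) + (∑ a, η q a * γ a s m x) = 0) :
    ∀ (x : Fin n → ℝ) (ρ μ ν : Fin n),
      Γ x ρ μ ν = (1 / 2) * ∑ σ, (g x)⁻¹ ρ σ *
        (fderiv ℝ (fun y => g y ν σ) x (Pi.single μ 1)
          + fderiv ℝ (fun y => g y μ σ) x (Pi.single ν 1)
          - fderiv ℝ (fun y => g y μ ν) x (Pi.single σ 1)) := by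
  intro x ρ μ ν
  have hd : ∀ i j, DifferentiableAt ℝ (fun y => h y i j) x := fun i j =>
    differentiableAt_pi.1 (differentiableAt_pi.1 (hC.differentiable one_ne_zero x) i) j
  have hgm : g = fun y => (h y)ᵀ * η * h y := by
    funext y
    ext a b
    rw [hg, Matrix.mul_apply, Finset.sum_comm]
    simp only [Matrix.mul_apply, Matrix.transpose_apply, Finset.sum_mul]
  have hdet := (Matrix.isUnit_iff_isUnit_det _).1 (hinv x)
  have hKH : (h x)⁻¹ * h x = 1 := Matrix.nonsing_inv_mul _ hdet
  have hgU : IsUnit (g x) := by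
    rw [hgm]
    exact (((h x).isUnit_transpose.2 (hinv x)).mul hηinv).mul (hinv x)
  let e : Fin n → Fin n → ℝ := fun τ => Pi.single τ 1
  set A : Fin n → Matrix (Fin n) (Fin n) ℝ := fun τ =>
    h x * Matrix.of (fun μ ρ => Γ x μ τ ρ) - entryDeriv h x (e τ) with hA
  have hγA : ∀ a s q, γ a s q x = ∑ τ, (h x)⁻¹ τ s * (A τ * (h x)⁻¹) a q := by
    intro a s q
    have h1 : ∀ τ, A τ * (h x)⁻¹ = h x * (Matrix.of (fun μ ρ => Γ x μ τ ρ) * (h x)⁻¹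
        + entryDeriv (fun y => (h y)⁻¹) x (e τ)) := by
      intro τ
      rw [mul_add, mul_entryDeriv_inv hd hinv, hA, sub_mul, sub_eq_add_neg, mul_assoc]
    simp only [h1]
    rw [hγ]
    simp only [Matrix.mul_apply (M := h x), Finset.mul_sum]
    rw [Finset.sum_comm]
    refine Finset.sum_congr rfl fun μ _ => ?_
    rw [← Finset.sum_add_distrib, Finset.mul_sum]
    refine Finset.sum_congr rfl fun τ _ => ?_
    simp only [Matrix.add_apply, Matrix.mul_apply, entryDeriv, Matrix.of_apply, mul_add,
      Finset.mul_sum]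
    congr 1
    · exact Finset.sum_congr rfl fun r _ => by ring
    · ring
  have hskewK : ∀ τ, η * (A τ * (h x)⁻¹) + (η * (A τ * (h x)⁻¹))ᵀ = 0 := by
    intro τ
    ext a b
    have hsum : ∀ s, ∑ t, (h x)⁻¹ t s *
        (η * (A t * (h x)⁻¹) + (η * (A t * (h x)⁻¹))ᵀ) a b = 0 := by
      intro s
      rw [← hmetricity a s b x]
      have h1 : ∀ a b, ∑ c, η a c * γ c s b x
          = ∑ t, (h x)⁻¹ t s * (η * (A t * (h x)⁻¹)) a b := by
        intro a b
        simp only [hγA, Matrix.mul_apply (M := η), Finset.mul_sum]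
        rw [Finset.sum_comm]
        exact Finset.sum_congr rfl fun t _ => Finset.sum_congr rfl fun c _ => by ring
      rw [h1, h1, ← Finset.sum_add_distrib]
      simp only [Matrix.add_apply, Matrix.transpose_apply, mul_add]
    have hz : (fun t => (η * (A t * (h x)⁻¹) + (η * (A t * (h x)⁻¹))ᵀ) a b) ᵥ* (h x)⁻¹ = 0 := by
      funext s
      rw [Matrix.vecMul, dotProduct_comm]
      exact hsum s
    exact congrFun (Matrix.eq_zero_of_vecMul_eq_zero
      (Matrix.isUnit_nonsing_inv_det _ hdet).ne_zero hz) τ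
  have hskew : ∀ τ, (h x)ᵀ * η * A τ + ((h x)ᵀ * η * A τ)ᵀ = 0 := by
    intro τ
    have h1 := congrArg (fun M => (h x)ᵀ * M * h x) (hskewK τ)
    have h2 : A τ * (h x)⁻¹ * h x = A τ := by rw [mul_assoc, hKH, mul_one]
    have h3 : (h x)ᵀ * (η * (A τ * (h x)⁻¹)) * h x = (h x)ᵀ * η * A τ := by
      rw [mul_assoc, mul_assoc η, h2, mul_assoc]
    have h4 : (h x)ᵀ * (η * (A τ * (h x)⁻¹))ᵀ * h x = ((h x)ᵀ * η * A τ)ᵀ := by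
      rw [← h3]
      simp only [Matrix.transpose_mul, Matrix.transpose_transpose, mul_assoc]
    simpa only [mul_add, add_mul, h3, h4, mul_zero, zero_mul] using h1
  refine christoffel_of_deriv_eq (dg := fun τ => entryDeriv g x (e τ)) hgU (hΓsymm x) ?_ ρ μ ν
  intro τ
  have hdg : entryDeriv g x (e τ) = (h x)ᵀ * η * entryDeriv h x (e τ)
      + ((h x)ᵀ * η * entryDeriv h x (e τ))ᵀ := by
    have hη : ∀ i j, DifferentiableAt ℝ (fun _ : Fin n → ℝ => η i j) x := fun _ _ =>
      differentiableAt_const _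
    have hT : ∀ i j, DifferentiableAt ℝ (fun y => (h y)ᵀ i j) x := fun i j => hd j i
    rw [hgm, entryDeriv_mul (differentiableAt_matrix_mul_apply hT hη) hd, entryDeriv_mul hT hη,
      entryDeriv_const, entryDeriv_transpose]
    simp only [Matrix.transpose_mul, Matrix.transpose_transpose, hηsymm.eq, mul_zero, add_zero,
      mul_assoc]
    exact add_comm _ _
  have h1 := hskew τ
  simp only [hA, mul_sub, Matrix.transpose_sub] at h1
  have h2 : g x * Matrix.of (fun μ ρ => Γ x μ τ ρ)
      = (h x)ᵀ * η * (h x * Matrix.of (fun μ ρ => Γ x μ τ ρ)) := by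
    rw [hgm, mul_assoc]
  rw [hdg, h2, ← sub_eq_zero, ← neg_eq_zero, ← h1]
  abel
end
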